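/- Let n be a positive integer divisible by 4 and let Γ = IOCG_n(D,σ) be an integral oriented circulant graph with Hermitian eigenvalues μ_0,…,μ_{n−1}. For 1 ≤ j ≤ n−1: if ν₂(j) = i−2 for some integer i with 2 ≤ i ≤ ν₂(n), then μ_j = Σ_{d ∈ D_i} σ(d) · (−1)^{(n/(2^i d)−1)/2} · (−1)^{(j/2^{i−2}+1)/2} · 2^{i−1} · c_{n/(2^i d)}(j/2^{i−2}); otherwise (i.e. if ν₂(j) > ν₂(n)−2) μ_j = 0; moreover μ_0 = 0. -/

import Mathlib

open Complex Finset

noncomputable section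

/-- `G_n^r(d) = { dk : k ≡ r (mod 4), gcd(dk, n) = d } ⊆ {1, …, n−1}`. -/
def Gsetr (n r d : ℕ) : Finset ℕ :=
  (Finset.range n).filter (fun a => d ∣ a ∧ (a / d) % 4 = r ∧ Nat.gcd a n = d)

/-- The symbol `C = ⋃_{d ∈ D} S_n(d)` of the integral oriented circulant graph
`IOCG_n(D, σ)`, where `S_n(d) = G_n^1(d)` if `σ d = 1` and `S_n(d) = G_n^3(d)` otherwise. -/
def symbol (n : ℕ) (D : Finset ℕ) (σ : ℕ → ℤ) : Finset ℕ :=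
  D.biUnion (fun d => Gsetr n (if σ d = 1 then 1 else 3) d)

/-- The Hermitian adjacency matrix of the oriented circulant graph with symbol `C`. -/
def hermMatrix (n : ℕ) [NeZero n] (C : Finset ℕ) : Matrix (ZMod n) (ZMod n) ℂ :=
  Matrix.of fun u v =>
    if (v - u).val ∈ C then Complex.I
    else if (u - v).val ∈ C then -Complex.I else 0

/-- The transition matrix `U(t) = exp(i t H)`. -/
def transitionMatrix (n : ℕ) [NeZero n] (C : Finset ℕ) (t : ℝ) :
    Matrix (ZMod n) (ZMod n) ℂ :=
  NormedSpace.exp ((Complex.I * (t : ℂ)) • hermMatrix n C)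

/-- Perfect state transfer from `u` to `v`. -/
def hasPST (n : ℕ) [NeZero n] (C : Finset ℕ) (u v : ZMod n) : Prop :=
  ∃ (t : ℝ) (γ : ℂ), ‖γ‖ = 1 ∧
    (transitionMatrix n C t).mulVec (Pi.single u 1) = γ • (Pi.single v 1 : ZMod n → ℂ)

/-- Multiple state transfer on a vertex set `S`: PST between every pair of
distinct vertices of `S`. -/
def hasMST (n : ℕ) [NeZero n] (C : Finset ℕ) (S : Set (ZMod n)) : Prop :=
  ∀ u ∈ S, ∀ v ∈ S, u ≠ v → hasPST n C u v

/-- The Hermitian eigenvalues `μ_j = i ∑_{k ∈ C} (ω^{jk} − ω^{−jk})`, `ω = exp(2πi/n)`. -/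
def eigval (n : ℕ) (C : Finset ℕ) (j : ℕ) : ℂ :=
  Complex.I * ∑ k ∈ C, (Complex.exp (2 * Real.pi * Complex.I * j * k / n) -
    Complex.exp (-(2 * Real.pi * Complex.I * j * k / n)))

/-- Ramanujan's sum `c_n(q) = ∑_{1 ≤ a ≤ n, gcd(a,n)=1} exp(2πi a q / n)`. -/
def ramanujanSum (n q : ℕ) : ℂ :=
  ∑ a ∈ (Finset.Icc 1 n).filter (fun a => Nat.gcd a n = 1),
    Complex.exp (2 * Real.pi * Complex.I * a * q / n)

/-- Ramanujan's sine sum `s_n(q) = i ∑_{a ∈ G_n^1(1)} (ω^{aq} − ω^{−aq})`. -/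
def sineSum (n q : ℕ) : ℂ :=
  Complex.I * ∑ a ∈ Gsetr n 1 1, (Complex.exp (2 * Real.pi * Complex.I * a * q / n) -
    Complex.exp (-(2 * Real.pi * Complex.I * a * q / n)))

/-- The twisted exponential sum `∑ χ₄(u) e(qu/N)` over the units `u` of `ZMod N`. -/
def chiFourSum (N : ℕ) [NeZero N] (h : 4 ∣ N) (q : ℕ) : ℂ :=
  ∑ u : (ZMod N)ˣ, ((ZMod.χ₄ (ZMod.castHom h (ZMod 4) (u : ZMod N)) : ℤ) : ℂ) *
    ZMod.stdAddChar ((q : ZMod N) * (u : ZMod N))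

lemma chiFour_mul_eq_ite_sub_ite (x r : ZMod 4) (hr : r = 1 ∨ r = 3) :
    ZMod.χ₄ r * ZMod.χ₄ x = (if x = r then 1 else 0) - (if -x = r then 1 else 0) := by
  rcases hr with rfl | rfl <;> revert x <;> decide

lemma stdAddChar_natCast (N : ℕ) [NeZero N] (a : ℕ) :
    ZMod.stdAddChar (a : ZMod N) = Complex.exp (2 * Real.pi * Complex.I * a / N) := by
  have := ZMod.stdAddChar_coe (N := N) (a : ℤ)
  push_cast at this
  exact this

lemma sum_Gsetr_eq_sum_units (d N r : ℕ) [NeZero N] (hd : 0 < d) (h : 4 ∣ N) (hr : r < 4)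
    (f : ℕ → ℂ) :
    ∑ a ∈ Gsetr (d * N) r d, f a =
      ∑ u : (ZMod N)ˣ, if ZMod.castHom h (ZMod 4) (u : ZMod N) = (r : ZMod 4)
        then f (d * (u : ZMod N).val) else 0 := by
  have hcast : ∀ u : (ZMod N)ˣ, ZMod.castHom h (ZMod 4) (u : ZMod N) = (r : ZMod 4) ↔
      (u : ZMod N).val % 4 = r := by
    intro u
    conv_lhs => rw [← ZMod.natCast_zmod_val (u : ZMod N), map_natCast,
      ZMod.natCast_eq_natCast_iff']
    rw [Nat.mod_eq_of_lt hr]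
  rw [← Finset.sum_filter]
  symm
  refine Finset.sum_bij (fun u _ => d * (u : ZMod N).val) ?_ ?_ ?_ (fun _ _ => rfl)
  · intro u hu
    rw [Finset.mem_filter, hcast] at hu
    simp only [Gsetr, Finset.mem_filter, Finset.mem_range]
    refine ⟨Nat.mul_lt_mul_of_pos_left (ZMod.val_lt _) hd, dvd_mul_right _ _, ?_, ?_⟩
    · rw [Nat.mul_div_cancel_left _ hd]; exact hu.2
    · rw [Nat.gcd_mul_left, (ZMod.val_coe_unit_coprime u).gcd_eq_one, mul_one]
  · intro u _ v _ huv
    exact Units.ext (ZMod.val_injective N (Nat.eq_of_mul_eq_mul_left hd huv))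
  · intro a ha
    simp only [Gsetr, Finset.mem_filter, Finset.mem_range] at ha
    obtain ⟨hlt, ⟨b, rfl⟩, hmod, hgcd⟩ := ha
    rw [Nat.mul_div_cancel_left _ hd] at hmod
    have hb : b < N := Nat.lt_of_mul_lt_mul_left hlt
    have hcop : Nat.Coprime b N := by
      rw [Nat.gcd_mul_left] at hgcd
      exact Nat.eq_of_mul_eq_mul_left hd (hgcd.trans (mul_one d).symm)
    have hval : ((ZMod.unitOfCoprime b hcop : (ZMod N)ˣ) : ZMod N).val = b := by
      rw [ZMod.coe_unitOfCoprime, ZMod.val_natCast, Nat.mod_eq_of_lt hb]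
    refine ⟨ZMod.unitOfCoprime b hcop, ?_, by rw [hval]⟩
    rw [Finset.mem_filter, hcast, hval]
    exact ⟨Finset.mem_univ _, hmod⟩

lemma eigval_Gsetr (d N r j : ℕ) [NeZero N] (hd : 0 < d) (h : 4 ∣ N) (hr : r = 1 ∨ r = 3) :
    eigval (d * N) (Gsetr (d * N) r d) j =
      Complex.I * ((ZMod.χ₄ (r : ZMod 4) : ℤ) : ℂ) * chiFourSum N h j := by
  have hd0 : (d : ℂ) ≠ 0 := Nat.cast_ne_zero.mpr hd.ne'
  have hexp : ∀ u : (ZMod N)ˣ,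
      2 * Real.pi * Complex.I * j * ((d * (u : ZMod N).val : ℕ) : ℂ) / ((d * N : ℕ) : ℂ) =
        2 * Real.pi * Complex.I * ((j * (u : ZMod N).val : ℕ) : ℂ) / N := by
    intro u
    have hN0 : (N : ℂ) ≠ 0 := Nat.cast_ne_zero.mpr (NeZero.ne N)
    push_cast
    field_simp
  have hval : ∀ u : (ZMod N)ˣ, ((j * (u : ZMod N).val : ℕ) : ZMod N) = j * u := by
    intro u
    rw [Nat.cast_mul, ZMod.natCast_zmod_val]
  rw [eigval, sum_Gsetr_eq_sum_units d N r hd h (by omega), mul_assoc Complex.I (_ : ℂ) (chiFourSum N h j)]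
  congr 1
  have hterm : ∀ u : (ZMod N)ˣ,
      Complex.exp (2 * Real.pi * Complex.I * j * ((d * (u : ZMod N).val : ℕ) : ℂ) /
          ((d * N : ℕ) : ℂ)) -
        Complex.exp (-(2 * Real.pi * Complex.I * j * ((d * (u : ZMod N).val : ℕ) : ℂ) /
          ((d * N : ℕ) : ℂ))) =
      ZMod.stdAddChar ((j : ZMod N) * (u : ZMod N)) - ZMod.stdAddChar ((j : ZMod N) * ((-u : (ZMod N)ˣ) : ZMod N)) := by
    intro u
    rw [hexp, Complex.exp_neg, ← stdAddChar_natCast, hval, Units.val_neg, mul_neg,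
      AddChar.map_neg_eq_inv]
  simp only [hterm]
  have hsplit : ∀ u : (ZMod N)ˣ,
      (if ZMod.castHom h (ZMod 4) (u : ZMod N) = (r : ZMod 4) then
        (ZMod.stdAddChar ((j : ZMod N) * (u : ZMod N)) -
          ZMod.stdAddChar ((j : ZMod N) * ((-u : (ZMod N)ˣ) : ZMod N)) : ℂ) else 0) =
      (if ZMod.castHom h (ZMod 4) (u : ZMod N) = (r : ZMod 4) then 1 else 0) *
          ZMod.stdAddChar ((j : ZMod N) * (u : ZMod N)) -
        (if ZMod.castHom h (ZMod 4) (u : ZMod N) = (r : ZMod 4) then 1 else 0) *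
          ZMod.stdAddChar ((j : ZMod N) * ((-u : (ZMod N)ˣ) : ZMod N)) := by
    intro u
    split_ifs <;> ring
  refine Eq.trans (Finset.sum_congr rfl fun u _ => hsplit u) ?_
  rw [Finset.sum_sub_distrib, ← Equiv.sum_comp (Equiv.neg (ZMod N)ˣ) (fun u =>
      (if ZMod.castHom h (ZMod 4) (u : ZMod N) = (r : ZMod 4) then (1 : ℂ) else 0) *
          ZMod.stdAddChar ((j : ZMod N) * ((-u : (ZMod N)ˣ) : ZMod N))), ← Finset.sum_sub_distrib,
    chiFourSum, Finset.mul_sum]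
  refine Finset.sum_congr rfl fun u _ => ?_
  have hchi := chiFour_mul_eq_ite_sub_ite (ZMod.castHom h (ZMod 4) (u : ZMod N)) (r : ZMod 4)
    (by rcases hr with rfl | rfl <;> simp)
  have hchi' := congrArg (Int.cast : ℤ → ℂ) hchi
  push_cast at hchi'
  rw [← mul_assoc, hchi', Equiv.neg_apply, neg_neg, Units.val_neg, map_neg]
  ring

lemma chiFourSum_eq_zero_of_unit (N : ℕ) [NeZero N] (h : 4 ∣ N) (q : ℕ) (w : (ZMod N)ˣ)
    (hw : ∀ u : (ZMod N)ˣ, ((ZMod.χ₄ (ZMod.castHom h (ZMod 4) (w : ZMod N)) : ℤ) : ℂ) *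
      ZMod.stdAddChar ((q : ZMod N) * ((w : ZMod N) - 1) * (u : ZMod N)) = -1) :
    chiFourSum N h q = 0 := by
  have key : chiFourSum N h q = -chiFourSum N h q := by
    conv_lhs => rw [chiFourSum, ← Equiv.sum_comp (Equiv.mulLeft w)]
    rw [chiFourSum, ← Finset.sum_neg_distrib]
    refine Finset.sum_congr rfl fun u _ => ?_
    have hsplit : (q : ZMod N) * ((Equiv.mulLeft w u : (ZMod N)ˣ) : ZMod N) =
        q * (w - 1) * u + q * u := by
      rw [Equiv.coe_mulLeft, Units.val_mul]; ring
    rw [hsplit, AddChar.map_add_eq_mul, Equiv.coe_mulLeft, Units.val_mul, map_mul, map_mul,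
      Int.cast_mul]
    linear_combination ((ZMod.χ₄ (ZMod.castHom h (ZMod 4) (u : ZMod N)) : ℤ) : ℂ) *
      ZMod.stdAddChar ((q : ZMod N) * (u : ZMod N)) * hw u
  linear_combination key / 2

lemma coprime_one_add_two_pow_mul (i k m : ℕ) (hk : 1 ≤ k) :
    Nat.Coprime (1 + 2 ^ k * m) (2 ^ i * m) := by
  obtain ⟨k, rfl⟩ := Nat.exists_eq_add_of_le' hk
  refine Nat.Coprime.mul_right (Nat.Coprime.pow_right _ ?_) ?_
  · rw [Nat.coprime_two_right, pow_succ]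
    exact ⟨2 ^ k * m, by ring⟩
  · simp

lemma chiFourSum_eq_zero_of_le (i m t : ℕ) [NeZero (2 ^ i * m)] (hi : 2 ≤ i) (hm : Odd m)
    (h : 4 ∣ 2 ^ i * m) : chiFourSum (2 ^ i * m) h (2 ^ (i - 1) * t) = 0 := by
  have hcop := coprime_one_add_two_pow_mul i 1 m le_rfl
  refine chiFourSum_eq_zero_of_unit _ h _ (ZMod.unitOfCoprime _ hcop) fun u => ?_
  rw [ZMod.coe_unitOfCoprime, map_natCast]
  have hchi : ZMod.χ₄ ((1 + 2 ^ 1 * m : ℕ) : ZMod 4) = -1 := by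
    rw [ZMod.χ₄_nat_three_mod_four]
    obtain ⟨l, rfl⟩ := hm
    omega
  have hzero : ((2 ^ (i - 1) * t : ℕ) : ZMod (2 ^ i * m)) *
      (((1 + 2 ^ 1 * m : ℕ) : ZMod (2 ^ i * m)) - 1) = 0 := by
    have : (((2 ^ i * m) * t : ℕ) : ZMod (2 ^ i * m)) = 0 := by
      rw [Nat.cast_mul, ZMod.natCast_self, zero_mul]
    rw [← this]
    obtain ⟨k, rfl⟩ := Nat.exists_eq_add_of_le' hi
    rw [show k + 2 - 1 = k + 1 by omega]
    push_cast
    ring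
  rw [hzero, hchi]
  simp

lemma stdAddChar_half_mul_odd (N M s : ℕ) [NeZero N] (hN : N = 2 * M) (hs : Odd s) :
    ZMod.stdAddChar ((M * s : ℕ) : ZMod N) = -1 := by
  have hM : (M : ℂ) ≠ 0 := by
    have := NeZero.ne N
    exact Nat.cast_ne_zero.mpr (by omega)
  rw [stdAddChar_natCast]
  obtain ⟨l, rfl⟩ := hs
  have : (2 * Real.pi * Complex.I * ((M * (2 * l + 1) : ℕ) : ℂ) / (N : ℂ)) =
      Real.pi * Complex.I + (l : ℕ) * (2 * Real.pi * Complex.I) := by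
    rw [hN]
    push_cast
    field_simp
    ring
  rw [this, Complex.exp_add, Complex.exp_nat_mul_two_pi_mul_I, Complex.exp_pi_mul_I, mul_one]

lemma odd_val_of_unit {N : ℕ} (h : 2 ∣ N) (u : (ZMod N)ˣ) : Odd (u : ZMod N).val :=
  Nat.coprime_two_right.mp ((ZMod.val_coe_unit_coprime u).coprime_dvd_right h)

lemma chiFourSum_eq_zero_of_lt (i v m t : ℕ) [NeZero (2 ^ i * m)] (hi : v + 2 < i)
    (ht : Odd t) (h : 4 ∣ 2 ^ i * m) : chiFourSum (2 ^ i * m) h (2 ^ v * t) = 0 := by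
  obtain ⟨s, rfl⟩ := Nat.exists_eq_add_of_lt hi
  have hcop := coprime_one_add_two_pow_mul (v + 2 + s + 1) (s + 2) m (by omega)
  refine chiFourSum_eq_zero_of_unit _ h _ (ZMod.unitOfCoprime _ hcop) fun u => ?_
  rw [ZMod.coe_unitOfCoprime, map_natCast]
  have hchi : ZMod.χ₄ ((1 + 2 ^ (s + 2) * m : ℕ) : ZMod 4) = 1 := by
    rw [ZMod.χ₄_nat_one_mod_four]
    rw [pow_add, show 1 + 2 ^ s * 2 ^ 2 * m = 1 + 4 * (2 ^ s * m) by ring]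
    omega
  have hodd : Odd (t * (u : ZMod (2 ^ (v + 2 + s + 1) * m)).val) :=
    ht.mul (odd_val_of_unit ((by norm_num : 2 ∣ 4).trans h) u)
  have hhalf := stdAddChar_half_mul_odd (2 ^ (v + 2 + s + 1) * m) (2 ^ (v + 2 + s) * m) _
    (by ring) hodd
  have harg : ((2 ^ v * t : ℕ) : ZMod (2 ^ (v + 2 + s + 1) * m)) *
      (((1 + 2 ^ (s + 2) * m : ℕ) : ZMod (2 ^ (v + 2 + s + 1) * m)) - 1) * u =
      ((2 ^ (v + 2 + s) * m * (t * (u : ZMod (2 ^ (v + 2 + s + 1) * m)).val) : ℕ) :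
        ZMod (2 ^ (v + 2 + s + 1) * m)) := by
    conv_lhs => rw [← ZMod.natCast_zmod_val (u : ZMod (2 ^ (v + 2 + s + 1) * m))]
    push_cast
    ring
  rw [harg, hhalf, hchi]
  simp

lemma exp_quarter_eq_chiFour (k : ℤ) (hk : Odd k) :
    Complex.exp (2 * Real.pi * Complex.I * k / 4) =
      Complex.I * ((ZMod.χ₄ (k : ZMod 4) : ℤ) : ℂ) := by
  have hpow : Complex.exp (2 * Real.pi * Complex.I * k / 4) = Complex.I ^ k := by
    rw [show 2 * Real.pi * Complex.I * k / 4 = k * (Real.pi / 2 * Complex.I) by ring,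
      Complex.exp_int_mul, Complex.exp_pi_div_two_mul_I]
  rw [hpow]
  have h4 : k = 4 * (k / 4) + 1 ∨ k = 4 * (k / 4) + 3 := by
    obtain ⟨l, rfl⟩ := hk
    omega
  have hI4 : (Complex.I : ℂ) ^ (4 * (k / 4)) = 1 := by
    rw [zpow_mul]
    norm_cast
    rw [Complex.I_pow_four, one_zpow]
  rcases h4 with h4 | h4
  · rw [ZMod.χ₄_int_one_mod_four (by omega), h4, zpow_add₀ Complex.I_ne_zero, hI4]
    simp
  · rw [ZMod.χ₄_int_three_mod_four (by omega), h4, zpow_add₀ Complex.I_ne_zero, hI4]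
    norm_cast
    simp [Complex.I_pow_three]

lemma chiFour_sq_of_odd (k : ℤ) (hk : Odd k) :
    ZMod.χ₄ (k : ZMod 4) * ZMod.χ₄ (k : ZMod 4) = 1 := by
  have h4 : k % 4 = 1 ∨ k % 4 = 3 := by
    obtain ⟨l, rfl⟩ := hk
    omega
  rcases h4 with h4 | h4
  · rw [ZMod.χ₄_int_one_mod_four h4]; norm_num
  · rw [ZMod.χ₄_int_three_mod_four h4]; norm_num

lemma chiFour_mul_exp (a t m c w : ℤ) (ha : Odd a) (ht : Odd t) (hm : Odd m)
    (hc : 4 * c + m * w = 1) :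
    ((ZMod.χ₄ (a : ZMod 4) : ℤ) : ℂ) *
        Complex.exp (2 * Real.pi * Complex.I * (t * a) / (4 * m)) =
      Complex.I * ((ZMod.χ₄ (m : ZMod 4) : ℤ) : ℂ) * ((ZMod.χ₄ (t : ZMod 4) : ℤ) : ℂ) *
        Complex.exp (2 * Real.pi * Complex.I * (c * (t * a)) / m) := by
  have hm0 : (m : ℂ) ≠ 0 := by
    have : m ≠ 0 := by rintro rfl; simp at hm
    exact_mod_cast this
  have hmw : Odd (m * w) := ⟨-2 * c, by linarith⟩
  have hw : Odd w := (Int.odd_mul.mp hmw).2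
  have hcC : (4 * c + m * w : ℂ) = 1 := by exact_mod_cast hc
  have hsplit : 2 * Real.pi * Complex.I * (t * a : ℂ) / (4 * m) =
      2 * Real.pi * Complex.I * ((a * t * w : ℤ) : ℂ) / 4 +
        2 * Real.pi * Complex.I * (c * (t * a)) / m := by
    push_cast
    field_simp
    linear_combination -(t * a : ℂ) * hcC
  rw [hsplit, Complex.exp_add, exp_quarter_eq_chiFour _ ((ha.mul ht).mul hw)]
  have hmw' : ZMod.χ₄ (m : ZMod 4) * ZMod.χ₄ (w : ZMod 4) = 1 := by
    rw [← map_mul, ← Int.cast_mul, ZMod.χ₄_int_one_mod_four (by omega)]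
  have hchi : ZMod.χ₄ (a : ZMod 4) * ZMod.χ₄ ((a * t * w : ℤ) : ZMod 4) =
      ZMod.χ₄ (m : ZMod 4) * ZMod.χ₄ (t : ZMod 4) := by
    push_cast
    rw [map_mul, map_mul]
    have h1 := chiFour_sq_of_odd a ha
    have h2 := chiFour_sq_of_odd m hm
    linear_combination ZMod.χ₄ (t : ZMod 4) * ZMod.χ₄ (w : ZMod 4) * h1
      - ZMod.χ₄ (t : ZMod 4) * ZMod.χ₄ (w : ZMod 4) * h2
      + ZMod.χ₄ (m : ZMod 4) * ZMod.χ₄ (t : ZMod 4) * hmw'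
  have hchi' := congrArg (Int.cast : ℤ → ℂ) hchi
  rw [Int.cast_mul (ZMod.χ₄ _), Int.cast_mul (ZMod.χ₄ _)] at hchi'
  linear_combination Complex.I *
    Complex.exp (2 * Real.pi * Complex.I * (c * (t * a)) / m) * hchi'

lemma ramanujanSum_eq_sum_units (m q : ℕ) [NeZero m] :
    ramanujanSum m q = ∑ u : (ZMod m)ˣ, ZMod.stdAddChar ((q : ZMod m) * (u : ZMod m)) := by
  rw [ramanujanSum]
  refine Finset.sum_bij (fun a ha => ZMod.unitOfCoprime a (Finset.mem_filter.mp ha).2)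
    (fun _ _ => Finset.mem_univ _) ?_ ?_ ?_
  · intro a ha b hb hab
    have hab' := congrArg (Units.val) hab
    rw [ZMod.coe_unitOfCoprime, ZMod.coe_unitOfCoprime, ZMod.natCast_eq_natCast_iff] at hab'
    simp only [Finset.mem_filter, Finset.mem_Icc] at ha hb
    exact hab'.eq_of_abs_lt (by rw [abs_lt]; omega)
  · intro u _
    have hcop := ZMod.val_coe_unit_coprime u
    have hlt := ZMod.val_lt (u : ZMod m)
    by_cases h0 : (u : ZMod m).val = 0
    · rw [h0, Nat.coprime_zero_left] at hcop
      subst hcop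
      exact ⟨1, by simp, Subsingleton.elim _ _⟩
    · exact ⟨(u : ZMod m).val, by
        rw [Finset.mem_filter, Finset.mem_Icc]
        exact ⟨⟨Nat.pos_of_ne_zero h0, hlt.le⟩, hcop⟩, Units.ext (by simp)⟩
  · intro a ha
    rw [ZMod.coe_unitOfCoprime, ← Nat.cast_mul, stdAddChar_natCast]
    congr 1
    push_cast
    ring

lemma sum_units_castHom (k m : ℕ) [NeZero k] [NeZero m] (hkm : Nat.Coprime k m)
    (g : ZMod m → ℂ) :
    ∑ u : (ZMod (k * m))ˣ, g (ZMod.castHom (dvd_mul_left m k) (ZMod m) (u : ZMod (k * m))) =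
      Nat.totient k * ∑ v : (ZMod m)ˣ, g v := by
  let e : (ZMod (k * m))ˣ ≃ (ZMod k)ˣ × (ZMod m)ˣ :=
    ((Units.mapEquiv (ZMod.chineseRemainder hkm).toMulEquiv).trans MulEquiv.prodUnits).toEquiv
  have he : ∀ u, ((e u).2 : ZMod m) =
      ZMod.castHom (dvd_mul_left m k) (ZMod m) (u : ZMod (k * m)) := by
    intro u
    exact congrArg (fun f : ZMod (k * m) →+* ZMod m => f u) (Subsingleton.elim
      ((RingHom.snd _ _).comp (ZMod.chineseRemainder hkm).toRingHom) _)
  simp only [← he]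
  rw [Equiv.sum_comp e (fun p => g p.2), Fintype.sum_prod_type]
  simp only
  rw [Finset.sum_const, Finset.card_univ, ZMod.card_units_eq_totient, nsmul_eq_mul]

lemma chiFourSum_eq_ramanujanSum (i m t : ℕ) [NeZero (2 ^ i * m)] (hi : 2 ≤ i) (hm : Odd m)
    (ht : Odd t) (h : 4 ∣ 2 ^ i * m) :
    chiFourSum (2 ^ i * m) h (2 ^ (i - 2) * t) =
      Complex.I * ((ZMod.χ₄ (m : ZMod 4) : ℤ) : ℂ) * ((ZMod.χ₄ (t : ZMod 4) : ℤ) : ℂ) *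
        2 ^ (i - 1) * ramanujanSum m t := by
  have : NeZero m := ⟨by rintro rfl; simp at hm⟩
  have hcop4 : Nat.Coprime 4 m := by
    rw [show 4 = 2 ^ 2 by norm_num]
    exact (Nat.coprime_two_left.mpr hm).pow_left 2
  obtain ⟨c, w, hc⟩ := Nat.isCoprime_iff_coprime.mpr hcop4
  have hc4 : 4 * c + m * w = 1 := by push_cast at hc; linarith
  have hunit : (4 : ZMod m) * (c : ZMod m) = 1 := by
    have := congrArg (Int.cast : ℤ → ZMod m) hc4
    push_cast at this
    rwa [ZMod.natCast_self, zero_mul, add_zero] at this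
  let z : (ZMod m)ˣ := ⟨c, 4, by rw [mul_comm, hunit], hunit⟩
  have hterm : ∀ u : (ZMod (2 ^ i * m))ˣ,
      ((ZMod.χ₄ (ZMod.castHom h (ZMod 4) (u : ZMod (2 ^ i * m))) : ℤ) : ℂ) *
        ZMod.stdAddChar (((2 ^ (i - 2) * t : ℕ) : ZMod (2 ^ i * m)) * (u : ZMod (2 ^ i * m))) =
      Complex.I * ((ZMod.χ₄ (m : ZMod 4) : ℤ) : ℂ) * ((ZMod.χ₄ (t : ZMod 4) : ℤ) : ℂ) *
        ZMod.stdAddChar ((c : ZMod m) * ((t : ZMod m) *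
          ZMod.castHom (dvd_mul_left m (2 ^ i)) (ZMod m) (u : ZMod (2 ^ i * m)))) := by
    intro u
    have ha := odd_val_of_unit ((by norm_num : 2 ∣ 4).trans h) u
    rw [← ZMod.natCast_zmod_val (u : ZMod (2 ^ i * m)), map_natCast (ZMod.castHom _ _),
      map_natCast (ZMod.castHom _ _)]
    generalize (u : ZMod (2 ^ i * m)).val = a at ha
    have key := chiFour_mul_exp a t m c w (by exact_mod_cast ha) (by exact_mod_cast ht)
      (by exact_mod_cast hm) hc4
    have hr : ZMod.stdAddChar ((c : ZMod m) * ((t : ZMod m) * (a : ZMod m))) =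
        Complex.exp (2 * Real.pi * Complex.I * (c * (t * a)) / m) := by
      have := ZMod.stdAddChar_coe (N := m) (c * (t * a))
      push_cast at this
      exact this
    have hl : ZMod.stdAddChar (((2 ^ (i - 2) * t : ℕ) : ZMod (2 ^ i * m)) * (a : ZMod (2 ^ i * m))) =
        Complex.exp (2 * Real.pi * Complex.I * (t * a) / (4 * m)) := by
      rw [← Nat.cast_mul, stdAddChar_natCast]
      congr 1
      obtain ⟨k, rfl⟩ := Nat.exists_eq_add_of_le' hi
      have hm0 : (m : ℂ) ≠ 0 := Nat.cast_ne_zero.mpr (NeZero.ne m)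
      rw [Nat.add_sub_cancel]
      push_cast
      field_simp
      ring
    rw [hl, hr]
    push_cast at key
    exact key
  rw [chiFourSum]
  simp only [hterm]
  rw [← Finset.mul_sum, sum_units_castHom (2 ^ i) m ((Nat.coprime_two_left.mpr hm).pow_left i)
    (fun x => ZMod.stdAddChar ((c : ZMod m) * ((t : ZMod m) * x))), ramanujanSum_eq_sum_units,
    ← Equiv.sum_comp (Equiv.mulLeft z) (fun v : (ZMod m)ˣ => ZMod.stdAddChar ((t : ZMod m) * (v : ZMod m))),
    Nat.totient_prime_pow Nat.prime_two (by omega)]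
  have hz : ∀ v : (ZMod m)ˣ, (t : ZMod m) * ((Equiv.mulLeft z v : (ZMod m)ˣ) : ZMod m) = c * (t * v) := by
    intro v
    rw [Equiv.coe_mulLeft, Units.val_mul]
    change (t : ZMod m) * (c * v) = _
    ring
  simp only [hz]
  push_cast
  ring

lemma padicValNat_two_pow_mul_odd (k s : ℕ) (hs : Odd s) : padicValNat 2 (2 ^ k * s) = k := by
  rw [padicValNat.mul (by positivity) hs.pos.ne', padicValNat.prime_pow,
    padicValNat.eq_zero_of_not_dvd hs.not_two_dvd_nat, add_zero]

lemma chiFourSum_eq_zero_of_padicValNat_ne (N q : ℕ) [NeZero N] (h : 4 ∣ N) (hq : q ≠ 0)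
    (hv : padicValNat 2 N ≠ padicValNat 2 q + 2) : chiFourSum N h q = 0 := by
  obtain ⟨i, m, hm, rfl⟩ := Nat.exists_eq_two_pow_mul_odd (NeZero.ne N)
  obtain ⟨v, t, ht, rfl⟩ := Nat.exists_eq_two_pow_mul_odd hq
  rw [padicValNat_two_pow_mul_odd _ _ hm, padicValNat_two_pow_mul_odd _ _ ht] at hv
  have hi : 2 ≤ i := by
    have := (padicValNat_dvd_iff_le (p := 2) (n := 2) (NeZero.ne (2 ^ i * m))).mp h
    rwa [padicValNat_two_pow_mul_odd _ _ hm] at this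
  rcases lt_or_ge (v + 2) i with hlt | hge
  · exact chiFourSum_eq_zero_of_lt i v m t hlt ht h
  · obtain ⟨s, rfl⟩ : ∃ s, v = i - 1 + s := ⟨v - (i - 1), by omega⟩
    rw [pow_add, mul_assoc]
    exact chiFourSum_eq_zero_of_le i m _ hi hm h

lemma eigval_symbol (n : ℕ) (D : Finset ℕ) (σ : ℕ → ℤ) (j : ℕ) :
    eigval n (symbol n D σ) j =
      ∑ d ∈ D, eigval n (Gsetr n (if σ d = 1 then 1 else 3) d) j := by
  simp only [eigval]
  rw [symbol, Finset.sum_biUnion, Finset.mul_sum]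
  intro d _ e _ hde
  rw [Function.onFun, Finset.disjoint_left]
  intro a ha hb
  simp only [Gsetr, Finset.mem_filter] at ha hb
  exact hde (ha.2.2.2.symm.trans hb.2.2.2)

lemma I_mul_chiFourSum (N j i : ℕ) [NeZero N] (h : 4 ∣ N) (hj : j ≠ 0) (hi : 2 ≤ i)
    (hN : padicValNat 2 N = i) (hv : padicValNat 2 j = i - 2) :
    Complex.I * chiFourSum N h j =
      (-1 : ℂ) ^ ((N / 2 ^ i - 1) / 2) * (-1 : ℂ) ^ ((j / 2 ^ (i - 2) + 1) / 2) * 2 ^ (i - 1) *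
        ramanujanSum (N / 2 ^ i) (j / 2 ^ (i - 2)) := by
  obtain ⟨i', m, hm, rfl⟩ := Nat.exists_eq_two_pow_mul_odd (NeZero.ne N)
  obtain ⟨v, t, ht, rfl⟩ := Nat.exists_eq_two_pow_mul_odd hj
  rw [padicValNat_two_pow_mul_odd _ _ hm] at hN
  rw [padicValNat_two_pow_mul_odd _ _ ht] at hv
  subst hN hv
  rw [chiFourSum_eq_ramanujanSum _ _ _ hi hm ht, Nat.mul_div_cancel_left _ (by positivity),
    Nat.mul_div_cancel_left _ (by positivity),
    ZMod.χ₄_eq_neg_one_pow (Nat.odd_iff.mp hm), ZMod.χ₄_eq_neg_one_pow (Nat.odd_iff.mp ht)]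
  have h1 : (m - 1) / 2 = m / 2 := by obtain ⟨l, rfl⟩ := hm; omega
  have h2 : (t + 1) / 2 = t / 2 + 1 := by obtain ⟨l, rfl⟩ := ht; omega
  rw [h1, h2, pow_succ]
  push_cast
  linear_combination ((-1 : ℂ) ^ (m / 2) * (-1 : ℂ) ^ (t / 2) * 2 ^ (i' - 1) *
    ramanujanSum m t) * Complex.I_mul_I

theorem eigval_formula (n : ℕ) [NeZero n] (hn4 : 4 ∣ n)
    (D : Finset ℕ) (hD : ∀ d ∈ D, d ∣ n / 4)
    (σ : ℕ → ℤ) (hσ : ∀ d ∈ D, σ d = 1 ∨ σ d = -1) :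
    eigval n (symbol n D σ) 0 = 0 ∧
    ∀ j, 1 ≤ j → j ≤ n - 1 →
      ((∀ i, 2 ≤ i → i ≤ padicValNat 2 n → padicValNat 2 j = i - 2 →
          eigval n (symbol n D σ) j =
            ∑ d ∈ D.filter (fun d => padicValNat 2 (n / d) = i),
              (σ d : ℂ) * (-1 : ℂ) ^ ((n / (2 ^ i * d) - 1) / 2) *
                (-1 : ℂ) ^ ((j / 2 ^ (i - 2) + 1) / 2) * 2 ^ (i - 1) *
                ramanujanSum (n / (2 ^ i * d)) (j / 2 ^ (i - 2))) ∧
        (padicValNat 2 j > padicValNat 2 n - 2 → eigval n (symbol n D σ) j = 0)) := by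
  refine ⟨by simp [eigval], fun j hj _ => ?_⟩
  have hn0 : n ≠ 0 := NeZero.ne n
  have hdvd : ∀ d ∈ D, ∃ N, n = d * N ∧ 4 ∣ N ∧ N ≠ 0 ∧ 0 < d := by
    intro d hd
    obtain ⟨k, hk⟩ := hD d hd
    have hn : n = d * (4 * k) := by
      rw [mul_left_comm, ← hk, Nat.mul_div_cancel' hn4]
    refine ⟨4 * k, hn, dvd_mul_right _ _, ?_, ?_⟩
    · intro h0
      exact hn0 (by rw [hn, h0, mul_zero])
    · exact Nat.pos_of_ne_zero fun h0 => hn0 (by rw [hn, h0, zero_mul])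
  have hterm : ∀ d N : ℕ, d ∈ D → n = d * N → ∀ (h : 4 ∣ N) [NeZero N], 0 < d →
      eigval n (Gsetr n (if σ d = 1 then 1 else 3) d) j =
        σ d * (Complex.I * chiFourSum N h j) := by
    intro d N hd hN h _ hd0
    rw [hN, eigval_Gsetr d N _ j hd0 h (by split_ifs <;> simp)]
    rcases hσ d hd with hs | hs
    · simp [hs]
    · have h3 : ZMod.χ₄ 3 = -1 := by decide
      simp [hs, h3]
  have hzero : ∀ d ∈ D, padicValNat 2 (n / d) ≠ padicValNat 2 j + 2 →
      eigval n (Gsetr n (if σ d = 1 then 1 else 3) d) j = 0 := by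
    intro d hd hv
    obtain ⟨N, hN, h, hN0, hd0⟩ := hdvd d hd
    have : NeZero N := ⟨hN0⟩
    rw [hN, Nat.mul_div_cancel_left _ hd0] at hv
    rw [hterm d N hd hN h hd0,
      chiFourSum_eq_zero_of_padicValNat_ne N j h (by omega) hv, mul_zero, mul_zero]
  rw [eigval_symbol]
  constructor
  · intro i hi _ hv
    rw [Finset.sum_filter]
    refine Finset.sum_congr rfl fun d hd => ?_
    by_cases hdi : padicValNat 2 (n / d) = i
    · rw [if_pos hdi]
      obtain ⟨N, hN, h, hN0, hd0⟩ := hdvd d hd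
      have : NeZero N := ⟨hN0⟩
      have hquot : n / (2 ^ i * d) = N / 2 ^ i := by
        rw [hN, mul_comm (2 ^ i) d, Nat.mul_div_mul_left _ _ hd0]
      have hNi : padicValNat 2 N = i := by
        rwa [hN, Nat.mul_div_cancel_left _ hd0] at hdi
      rw [hterm d N hd hN h hd0, I_mul_chiFourSum N j i h (by omega) hi hNi hv, hquot]
      ring
    · rw [if_neg hdi]
      exact hzero d hd (by omega)
  · intro hv
    refine Finset.sum_eq_zero fun d hd => hzero d hd ?_
    have hle : padicValNat 2 (n / d) ≤ padicValNat 2 n := by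
      obtain ⟨N, hN, h, hN0, hd0⟩ := hdvd d hd
      rw [hN, Nat.mul_div_cancel_left _ hd0, padicValNat.mul hd0.ne' hN0]
      exact Nat.le_add_left _ _
    omega

end
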